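/- For g = osp(1|2n)^{(1)} and any 1≤i,j≤n with i≠j and (α_i,α_j)=−1 (i.e. |i−j|=1), the vertex operators satisfy the formal identity (z − q^{−1}w)·X⁺_i(z)X⁺_j(w) = (q^{−1}z − w)·X⁺_j(w)X⁺_i(z) of operator-valued formal series on V; equivalently, comparing coefficients in the mode expansions, for all mode indices k,l: X⁺_i(k+1)X⁺_j(l) − q^{−1}X⁺_i(k)X⁺_j(l+1) = q^{−1}X⁺_j(l)X⁺_i(k+1) − X⁺_j(l+1)X⁺_i(k) as linear operators on V. -/

import Mathlib

set_option synthInstance.maxHeartbeats 1000000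
set_option maxHeartbeats 1000000

noncomputable section

open scoped BigOperators

/-! ## The base field and basic scalars -/

/-- The base field `K = ℂ(q^{1/2})`. -/
abbrev KK : Type := RatFunc ℂ

/-- `q^{1/2}`. -/
def qh : KK := RatFunc.X

/-- integer powers of `q^{1/2}`. -/
def qpow (m : ℤ) : KK := qh ^ m

/-- a fixed square root of `−1`. -/
def ii : KK := RatFunc.C Complex.I

/-- The three series of affine Lie superalgebras. -/
inductive Gcase : Type
  | osp1  -- osp(1|2n)^{(1)}
  | sl2   -- sl(1|2n)^{(2)}
  | osp2  -- osp(2|2n)^{(2)}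
deriving DecidableEq

/-! ## Root data (normalisation `(α_n, α_n) = 1`), affine indices `0, 1, …, n` -/

/-- The symmetric bilinear form `(α_i, α_j)` on the simple roots, paper indices `0 ≤ i,j ≤ n`. -/
def Bc (c : Gcase) (n : ℕ) (i j : ℕ) : ℤ :=
  if i = j then
    (match c with
      | .osp1 => if i = 0 then 4 else if i = n then 1 else 2
      | .sl2 => if i = n then 1 else 2
      | .osp2 => if i = 0 ∨ i = n then 1 else 2)
  else if i + 1 = j ∨ j + 1 = i then
    (match c with
      | .osp1 => if i = 0 ∨ j = 0 then -2 else -1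
      | .sl2 => if i = 0 ∨ j = 0 then 0 else -1
      | .osp2 => -1)
  else if (i = 0 ∧ j = 2) ∨ (j = 0 ∧ i = 2) then
    (match c with | .sl2 => -1 | _ => 0)
  else 0

/-- Parity of the simple root `α_i` (`1` = odd, `0` = even). -/
def pc (c : Gcase) (n : ℕ) (i : ℕ) : ℕ :=
  match c with
  | .osp2 => if i = 0 ∨ i = n then 1 else 0
  | _ => if i = n then 1 else 0

/-- The structure constants `u_{i,j,r}` of the Drinfeld realisation (paper indices `1 ≤ i,j ≤ n`). -/
def uconst (c : Gcase) (n : ℕ) (i j : ℕ) (r : ℤ) : KK :=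
  match c with
  | .osp1 =>
      if i = n ∧ j = n then qpow (4 * r) - qpow (-(4 * r)) - qpow (2 * r) + qpow (-(2 * r))
      else qpow (2 * r * Bc c n i j) - qpow (-(2 * r * Bc c n i j))
  | .sl2 =>
      if i = n ∧ j = n then ((-1 : KK) ^ r) * (qpow (2 * r) - qpow (-(2 * r)))
      else qpow (2 * r * Bc c n i j) - qpow (-(2 * r * Bc c n i j))
  | .osp2 =>
      if i = n ∧ j = n then ((-1 : KK) ^ r) * (qpow (2 * r) - qpow (-(2 * r)))
      else (1 + (-1 : KK) ^ r) * (qpow (r * Bc c n i j) - qpow (-(r * Bc c n i j)))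

/-! ## The Drinfeld superalgebra `U_q^D(g)` -/

/-- Generators of the Drinfeld superalgebra: `ξ⁺_{i,r}`, `ξ⁻_{i,r}`, `γ_i`, `γ_i⁻¹`, `κ_{i,s}`,
`γ^{1/2}`, `γ^{−1/2}`.  Here `i : Fin n` stands for the paper's index `i + 1 ∈ {1, …, n}`. -/
inductive DGen (n : ℕ) : Type
  | xp : Fin n → ℤ → DGen n
  | xm : Fin n → ℤ → DGen n
  | ga : Fin n → DGen n
  | gai : Fin n → DGen n
  | ka : Fin n → ℤ → DGen n
  | gh : DGen n
  | ghi : DGen n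

/-- The free algebra on the Drinfeld generators. -/
abbrev DF (n : ℕ) : Type := FreeAlgebra KK (DGen n)

def dXp {n : ℕ} (i : Fin n) (r : ℤ) : DF n := FreeAlgebra.ι KK (DGen.xp i r)
def dXm {n : ℕ} (i : Fin n) (r : ℤ) : DF n := FreeAlgebra.ι KK (DGen.xm i r)
def dGa {n : ℕ} (i : Fin n) : DF n := FreeAlgebra.ι KK (DGen.ga i)
def dGai {n : ℕ} (i : Fin n) : DF n := FreeAlgebra.ι KK (DGen.gai i)
def dKa {n : ℕ} (i : Fin n) (s : ℤ) : DF n := FreeAlgebra.ι KK (DGen.ka i s)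
def dGh (n : ℕ) : DF n := FreeAlgebra.ι KK (DGen.gh : DGen n)
def dGhi (n : ℕ) : DF n := FreeAlgebra.ι KK (DGen.ghi : DGen n)

/-- paper index of `i : Fin n`. -/
def pid {n : ℕ} (i : Fin n) : ℕ := (i : ℕ) + 1

def dB (c : Gcase) (n : ℕ) (i j : Fin n) : ℤ := Bc c n (pid i) (pid j)
def du (c : Gcase) (n : ℕ) (i j : Fin n) (r : ℤ) : KK := uconst c n (pid i) (pid j) r
/-- `q_i = q^{(α_i,α_i)/2}`. -/
def dqi (c : Gcase) (n : ℕ) (i : Fin n) : KK := qpow (dB c n i i)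
/-- `q_i − q_i⁻¹`. -/
def dden (c : Gcase) (n : ℕ) (i : Fin n) : KK := dqi c n i - (dqi c n i)⁻¹
/-- parity of `ξ^±_{i,r}`. -/
def dpar (n : ℕ) (i : Fin n) : ℕ := if pid i = n then 1 else 0
/-- the admissible index set `I_g`. -/
def dadm (c : Gcase) (n : ℕ) (i : Fin n) (r : ℤ) : Prop :=
  c ≠ .osp2 ∨ pid i = n ∨ r % 2 = 0
/-- `γ^{m/2}` as a word in the generators `γ^{±1/2}`. -/
def dgampow (n : ℕ) (m : ℤ) : DF n :=
  if 0 ≤ m then (dGh n) ^ m.toNat else (dGhi n) ^ (-m).toNat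

/-- the Cartan integer `a_{ij} = 2(α_i,α_j)/(α_i,α_i)`. -/
def dacart (c : Gcase) (n : ℕ) (i j : Fin n) : ℤ := 2 * dB c n i j / dB c n i i
/-- the shift `θ` in Serre relation (A). -/
def dtheta (c : Gcase) (n : ℕ) (i j : Fin n) : ℤ :=
  match c with
  | .osp2 => if pid i = n ∧ pid j = n then 1 else 2
  | _ => 1

/-- The elements `κ̂⁺_{i,m}`, defined from the `κ`'s by the exponential generating series
`Σ_{m≥0} κ̂⁺_{i,m} u^{−m} = γ_i exp((q_i−q_i⁻¹) Σ_{m>0} κ_{i,m} u^{−m})`, here characterised by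
the equivalent recursion `(m+1) κ̂⁺_{i,m+1} = (q_i−q_i⁻¹) Σ_{r=1}^{m+1} r κ_{i,r} κ̂⁺_{i,m+1−r}`
(valid since the `κ_{i,r}`, `r > 0`, commute), `κ̂⁺_{i,0} = γ_i`. -/
def khatp (c : Gcase) (n : ℕ) (i : Fin n) : ℕ → DF n
  | 0 => dGa i
  | (m + 1) =>
      (((m : KK) + 1))⁻¹ • (dden c n i •
        ∑ r ∈ Finset.range (m + 1),
          (((r : ℕ) + 1 : ℕ) : KK) • (dKa i ((r : ℤ) + 1) * khatp c n i (m - r)))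
  decreasing_by exact Nat.lt_succ_of_le (Nat.sub_le m r)

/-- The elements `κ̂⁻_{i,−m}`, defined by
`Σ_{m≥0} κ̂⁻_{i,−m} u^{m} = γ_i⁻¹ exp((q_i⁻¹−q_i) Σ_{m>0} κ_{i,−m} u^{m})`. -/
def khatm (c : Gcase) (n : ℕ) (i : Fin n) : ℕ → DF n
  | 0 => dGai i
  | (m + 1) =>
      (((m : KK) + 1))⁻¹ • ((-(dden c n i)) •
        ∑ r ∈ Finset.range (m + 1),
          (((r : ℕ) + 1 : ℕ) : KK) • (dKa i (-((r : ℤ) + 1)) * khatm c n i (m - r)))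
  decreasing_by exact Nat.lt_succ_of_le (Nat.sub_le m r)

/-- `κ̂⁺_{i,r}` for `r : ℤ` (zero for `r < 0`). -/
def DKhatP (c : Gcase) (n : ℕ) (i : Fin n) (r : ℤ) : DF n :=
  if 0 ≤ r then khatp c n i r.toNat else 0

/-- `κ̂⁻_{i,r}` for `r : ℤ` (zero for `r > 0`). -/
def DKhatM (c : Gcase) (n : ℕ) (i : Fin n) (r : ℤ) : DF n :=
  if r ≤ 0 then khatm c n i (-r).toNat else 0

/-- the twisted bracket `[x,y]_a = xy − (−1)^{[x][y]} a · yx` for homogeneous `x, y` of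
parities `px, py`. -/
def sbr {n : ℕ} (px py : ℕ) (a : KK) (x y : DF n) : DF n :=
  x * y - (((-1 : KK) ^ (px * py)) * a) • (y * x)

/-- `[m]_z`. -/
def qint (z : KK) (m : ℕ) : KK := (z ^ m - z⁻¹ ^ m) / (z - z⁻¹)
/-- `[m]_z!`. -/
def qfact (z : KK) : ℕ → KK
  | 0 => 1
  | (m + 1) => qint z (m + 1) * qfact z m
/-- the Gaussian binomial coefficient `[N; k]_z`. -/
def qbinom (z : KK) (N k : ℕ) : KK := qfact z N / (qfact z k * qfact z (N - k))

/-- `sym_{r_1,…,r_ℓ} Σ_{k=0}^{ℓ} coef k · A_{r_{σ(1)}} ⋯ A_{r_{σ(k)}} · b · A_{r_{σ(k+1)}} ⋯`. -/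
def serreSum {n : ℕ} (ℓ : ℕ) (A : Fin ℓ → DF n) (b : DF n) (coef : ℕ → KK) : DF n :=
  ∑ σ : Equiv.Perm (Fin ℓ), ∑ k ∈ Finset.range (ℓ + 1),
    coef k • (((List.ofFn fun m => A (σ m)).take k).prod * b *
      ((List.ofFn fun m => A (σ m)).drop k).prod)

/-- The defining relations of the Drinfeld superalgebra `U_q^D(g)` (Definition 2.2 of the
paper).  Non-admissible generators (which occur for `osp(2|2n)^{(2)}`) and the generators
`κ_{i,0}` are set to zero. -/
inductive DRel (c : Gcase) (n : ℕ) : DF n → DF n → Prop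
  | killxp (i : Fin n) (r : ℤ) (h : ¬ dadm c n i r) : DRel c n (dXp i r) 0
  | killxm (i : Fin n) (r : ℤ) (h : ¬ dadm c n i r) : DRel c n (dXm i r) 0
  | killka (i : Fin n) (r : ℤ) (h : ¬ dadm c n i r ∨ r = 0) : DRel c n (dKa i r) 0
  -- `γ^{±1/2}` central, mutually inverse
  | gh_ghi : DRel c n (dGh n * dGhi n) 1
  | ghi_gh : DRel c n (dGhi n * dGh n) 1
  | gh_central (g : DGen n) :
      DRel c n (dGh n * FreeAlgebra.ι KK g) (FreeAlgebra.ι KK g * dGh n)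
  | ghi_central (g : DGen n) :
      DRel c n (dGhi n * FreeAlgebra.ι KK g) (FreeAlgebra.ι KK g * dGhi n)
  -- `γ_i` invertible, mutually commuting
  | ga_gai (i : Fin n) : DRel c n (dGa i * dGai i) 1
  | gai_ga (i : Fin n) : DRel c n (dGai i * dGa i) 1
  | ga_comm (i j : Fin n) : DRel c n (dGa i * dGa j) (dGa j * dGa i)
  | ga_ka (i j : Fin n) (s : ℤ) : DRel c n (dGa i * dKa j s) (dKa j s * dGa i)
  -- `γ_i ξ^±_{j,r} γ_i⁻¹ = q_i^{± a_{ij}} ξ^±_{j,r}`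
  | ga_xp (i j : Fin n) (r : ℤ) :
      DRel c n (dGa i * dXp j r * dGai i) (qpow (2 * dB c n i j) • dXp j r)
  | ga_xm (i j : Fin n) (r : ℤ) :
      DRel c n (dGa i * dXm j r * dGai i) (qpow (-(2 * dB c n i j)) • dXm j r)
  -- `[κ_{i,r}, ξ^±_{j,s}] = (u_{i,j,r} γ^{∓|r|/2} / (r(q_i−q_i⁻¹))) ξ^±_{j,s+r}`
  | ka_xp (i j : Fin n) (r s : ℤ) (hr : r ≠ 0) :
      DRel c n (dKa i r * dXp j s - dXp j s * dKa i r)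
        ((du c n i j r / ((r : KK) * dden c n i)) • (dgampow n (-|r|) * dXp j (s + r)))
  | ka_xm (i j : Fin n) (r s : ℤ) (hr : r ≠ 0) :
      DRel c n (dKa i r * dXm j s - dXm j s * dKa i r)
        ((du c n i j r / ((r : KK) * dden c n i)) • (dgampow n |r| * dXm j (s + r)))
  -- `[κ_{i,r}, κ_{j,s}] = δ_{r+s,0} u_{i,j,r}(γ^r − γ^{−r})/(r(q_i−q_i⁻¹)(q_j−q_j⁻¹))`
  | ka_ka (i j : Fin n) (r s : ℤ) (hr : r ≠ 0) (hs : s ≠ 0) :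
      DRel c n (dKa i r * dKa j s - dKa j s * dKa i r)
        (if s = -r then
          (du c n i j r / ((r : KK) * dden c n i * dden c n j)) •
            (dgampow n (2 * r) - dgampow n (-(2 * r)))
         else 0)
  -- `[ξ⁺_{i,r}, ξ⁻_{j,s}] = δ_{ij}(γ^{(r−s)/2} κ̂⁺_{i,r+s} − γ^{(s−r)/2} κ̂⁻_{i,r+s})/(q_i−q_i⁻¹)`
  | xpxm (i j : Fin n) (r s : ℤ) :
      DRel c n (dXp i r * dXm j s - ((-1 : KK) ^ (dpar n i * dpar n j)) • (dXm j s * dXp i r))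
        (if i = j then
          (dden c n i)⁻¹ •
            (dgampow n (r - s) * DKhatP c n i (r + s) - dgampow n (s - r) * DKhatM c n i (r + s))
         else 0)
  -- Serre relation (A)
  | serreA_p (i j : Fin n) (r s : ℤ) (h : ¬(c = Gcase.osp1 ∧ pid i = n ∧ pid j = n)) :
      DRel c n
        (sbr (dpar n i) (dpar n j) (qpow (2 * dB c n i j)) (dXp i (r + dtheta c n i j)) (dXp j s) +
         sbr (dpar n j) (dpar n i) (qpow (2 * dB c n j i)) (dXp j (s + dtheta c n i j)) (dXp i r)) 0
  | serreA_m (i j : Fin n) (r s : ℤ) (h : ¬(c = Gcase.osp1 ∧ pid i = n ∧ pid j = n)) :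
      DRel c n
        (sbr (dpar n i) (dpar n j) (qpow (2 * dB c n i j)) (dXm i (r - dtheta c n i j)) (dXm j s) +
         sbr (dpar n j) (dpar n i) (qpow (2 * dB c n j i)) (dXm j (s - dtheta c n i j)) (dXm i r)) 0
  -- Serre relation (B)
  | serreB_p (i j : Fin n) (hij : i ≠ j) (hi : pid i ≠ n)
      (rv : Fin (1 - dacart c n i j).toNat → ℤ) (s : ℤ) :
      DRel c n
        (serreSum (1 - dacart c n i j).toNat (fun m => dXp i (rv m)) (dXp j s)
          (fun k => ((-1 : KK) ^ k) * qbinom (dqi c n i) (1 - dacart c n i j).toNat k)) 0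
  | serreB_m (i j : Fin n) (hij : i ≠ j) (hi : pid i ≠ n)
      (rv : Fin (1 - dacart c n i j).toNat → ℤ) (s : ℤ) :
      DRel c n
        (serreSum (1 - dacart c n i j).toNat (fun m => dXm i (rv m)) (dXm j s)
          (fun k => ((-1 : KK) ^ k) * qbinom (dqi c n i) (1 - dacart c n i j).toNat k)) 0
  -- Serre relation (C)
  | serreC_p (i j : Fin n) (hi : pid i = n)
      (hj : (c = Gcase.sl2 ∧ pid j ≠ n) ∨ (c ≠ Gcase.sl2 ∧ pid j + 1 < n))
      (rv : Fin (1 - dacart c n i j).toNat → ℤ) (s : ℤ) :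
      DRel c n
        (serreSum (1 - dacart c n i j).toNat (fun m => dXp i (rv m)) (dXp j s)
          (fun k => qbinom (ii * dqi c n i) (1 - dacart c n i j).toNat k)) 0
  | serreC_m (i j : Fin n) (hi : pid i = n)
      (hj : (c = Gcase.sl2 ∧ pid j ≠ n) ∨ (c ≠ Gcase.sl2 ∧ pid j + 1 < n))
      (rv : Fin (1 - dacart c n i j).toNat → ℤ) (s : ℤ) :
      DRel c n
        (serreSum (1 - dacart c n i j).toNat (fun m => dXm i (rv m)) (dXm j s)
          (fun k => qbinom (ii * dqi c n i) (1 - dacart c n i j).toNat k)) 0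
  -- Serre relations (D), only for osp(1|2n)^{(1)}
  | serreD1_p (hc : c = Gcase.osp1) (i : Fin n) (hi : pid i = n) (rv : Fin 3 → ℤ) :
      DRel c n
        (∑ σ : Equiv.Perm (Fin 3),
          sbr 0 1 (qpow 4)
            (sbr 1 1 (qpow 2) (dXp i (rv (σ 0) + 1)) (dXp i (rv (σ 1)))) (dXp i (rv (σ 2)))) 0
  | serreD1_m (hc : c = Gcase.osp1) (i : Fin n) (hi : pid i = n) (rv : Fin 3 → ℤ) :
      DRel c n
        (∑ σ : Equiv.Perm (Fin 3),
          sbr 0 1 (qpow 4)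
            (sbr 1 1 (qpow 2) (dXm i (rv (σ 0) - 1)) (dXm i (rv (σ 1)))) (dXm i (rv (σ 2)))) 0
  | serreD2_p (hc : c = Gcase.osp1) (i : Fin n) (hi : pid i = n) (rv : Fin 2 → ℤ) :
      DRel c n
        (∑ σ : Equiv.Perm (Fin 2),
          (sbr 1 1 (qpow 2) (dXp i (rv (σ 0) + 2)) (dXp i (rv (σ 1))) -
            qpow 4 • sbr 1 1 (qpow (-6)) (dXp i (rv (σ 0) + 1)) (dXp i (rv (σ 1) + 1)))) 0
  | serreD2_m (hc : c = Gcase.osp1) (i : Fin n) (hi : pid i = n) (rv : Fin 2 → ℤ) :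
      DRel c n
        (∑ σ : Equiv.Perm (Fin 2),
          (sbr 1 1 (qpow 2) (dXm i (rv (σ 0) - 2)) (dXm i (rv (σ 1))) -
            qpow 4 • sbr 1 1 (qpow (-6)) (dXm i (rv (σ 0) - 1)) (dXm i (rv (σ 1) - 1)))) 0
  | serreD3_p (hc : c = Gcase.osp1) (i i' : Fin n) (hi : pid i = n) (hi' : pid i' + 1 = n)
      (rv : Fin 2 → ℤ) (k : ℤ) :
      DRel c n
        (∑ σ : Equiv.Perm (Fin 2),
          (qpow 2 • sbr 0 0 (qpow 4)
              (sbr 1 1 (qpow 2) (dXp i (rv (σ 0) + 1)) (dXp i (rv (σ 1)))) (dXp i' k) +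
           (qpow 2 + qpow (-2)) • sbr 1 1 1
              (sbr 0 1 (qpow 2) (dXp i' k) (dXp i (rv (σ 0) + 1))) (dXp i (rv (σ 1))))) 0
  | serreD3_m (hc : c = Gcase.osp1) (i i' : Fin n) (hi : pid i = n) (hi' : pid i' + 1 = n)
      (rv : Fin 2 → ℤ) (k : ℤ) :
      DRel c n
        (∑ σ : Equiv.Perm (Fin 2),
          (qpow 2 • sbr 0 0 (qpow 4)
              (sbr 1 1 (qpow 2) (dXm i (rv (σ 0) - 1)) (dXm i (rv (σ 1)))) (dXm i' k) +
           (qpow 2 + qpow (-2)) • sbr 1 1 1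
              (sbr 0 1 (qpow 2) (dXm i' k) (dXm i (rv (σ 0) - 1))) (dXm i (rv (σ 1))))) 0
  -- Serre relation (E), only for osp(2|2n)^{(2)}
  | serreE_p (hc : c = Gcase.osp2) (i i' : Fin n) (hi : pid i = n) (hi' : pid i' + 1 = n)
      (rv : Fin 2 → ℤ) (k : ℤ) :
      DRel c n
        (∑ σ : Equiv.Perm (Fin 2),
          sbr 1 1 1 (sbr 0 1 (qpow 2) (dXp i' k) (dXp i (rv (σ 0) + 1))) (dXp i (rv (σ 1)))) 0
  | serreE_m (hc : c = Gcase.osp2) (i i' : Fin n) (hi : pid i = n) (hi' : pid i' + 1 = n)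
      (rv : Fin 2 → ℤ) (k : ℤ) :
      DRel c n
        (∑ σ : Equiv.Perm (Fin 2),
          sbr 1 1 1 (sbr 0 1 (qpow 2) (dXm i' k) (dXm i (rv (σ 0) - 1))) (dXm i (rv (σ 1)))) 0

/-- The Drinfeld superalgebra `U_q^D(g)`. -/
abbrev UqD (c : Gcase) (n : ℕ) : Type := RingQuot (DRel c n)

/-- the quotient map. -/
def dπ (c : Gcase) (n : ℕ) : DF n →ₐ[KK] UqD c n := RingQuot.mkAlgHom KK (DRel c n)

def vXp (c : Gcase) (n : ℕ) (i : Fin n) (r : ℤ) : UqD c n := dπ c n (dXp i r)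
def vXm (c : Gcase) (n : ℕ) (i : Fin n) (r : ℤ) : UqD c n := dπ c n (dXm i r)
def vGa (c : Gcase) (n : ℕ) (i : Fin n) : UqD c n := dπ c n (dGa i)
def vGai (c : Gcase) (n : ℕ) (i : Fin n) : UqD c n := dπ c n (dGai i)
def vKa (c : Gcase) (n : ℕ) (i : Fin n) (s : ℤ) : UqD c n := dπ c n (dKa i s)
def vGh (c : Gcase) (n : ℕ) : UqD c n := dπ c n (dGh n)
def vGhi (c : Gcase) (n : ℕ) : UqD c n := dπ c n (dGhi n)
/-- `γ = (γ^{1/2})²`. -/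
def vGam (c : Gcase) (n : ℕ) : UqD c n := vGh c n * vGh c n
/-- `γ⁻¹`. -/
def vGamInv (c : Gcase) (n : ℕ) : UqD c n := vGhi c n * vGhi c n

/-! ## The quantum affine superalgebra `U_q(g)` in the Chevalley presentation -/

/-- Chevalley generators `e_i`, `f_i`, `k_i`, `k_i⁻¹`, `0 ≤ i ≤ n`. -/
inductive CGen (n : ℕ) : Type
  | e : Fin (n + 1) → CGen n
  | f : Fin (n + 1) → CGen n
  | k : Fin (n + 1) → CGen n
  | ki : Fin (n + 1) → CGen n

abbrev CF (n : ℕ) : Type := FreeAlgebra KK (CGen n)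

def cE {n : ℕ} (i : Fin (n + 1)) : CF n := FreeAlgebra.ι KK (CGen.e i)
def cF {n : ℕ} (i : Fin (n + 1)) : CF n := FreeAlgebra.ι KK (CGen.f i)
def cK {n : ℕ} (i : Fin (n + 1)) : CF n := FreeAlgebra.ι KK (CGen.k i)
def cKi {n : ℕ} (i : Fin (n + 1)) : CF n := FreeAlgebra.ι KK (CGen.ki i)

def cB (c : Gcase) (n : ℕ) (i j : Fin (n + 1)) : ℤ := Bc c n (i : ℕ) (j : ℕ)
def cpar (c : Gcase) (n : ℕ) (i : Fin (n + 1)) : ℕ := pc c n (i : ℕ)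
def cqi (c : Gcase) (n : ℕ) (i : Fin (n + 1)) : KK := qpow (cB c n i i)
def cden (c : Gcase) (n : ℕ) (i : Fin (n + 1)) : KK := cqi c n i - (cqi c n i)⁻¹
def cacart (c : Gcase) (n : ℕ) (i j : Fin (n + 1)) : ℤ := 2 * cB c n i j / cB c n i i

/-- `Ad_{e_i}(x) = e_i x − (−1)^{[e_i][x]} k_i x k_i⁻¹ e_i` (`p` = parity of `x`). -/
def adE (c : Gcase) (n : ℕ) (i : Fin (n + 1)) (p : ℕ) (x : CF n) : CF n :=
  cE i * x - ((-1 : KK) ^ (cpar c n i * p)) • (cK i * x * cKi i * cE i)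

/-- `Ad_{f_i}(x) = f_i x − (−1)^{[f_i][x]} k_i⁻¹ x k_i f_i`. -/
def adF (c : Gcase) (n : ℕ) (i : Fin (n + 1)) (p : ℕ) (x : CF n) : CF n :=
  cF i * x - ((-1 : KK) ^ (cpar c n i * p)) • (cKi i * x * cK i * cF i)

/-- `(Ad_{e_i})^m (x)` for `x` of parity `p0` (with parity book-keeping). -/
def adEiter (c : Gcase) (n : ℕ) (i : Fin (n + 1)) (p0 : ℕ) : ℕ → CF n → CF n
  | 0, x => x
  | (m + 1), x => adE c n i (cpar c n i * m + p0) (adEiter c n i p0 m x)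

def adFiter (c : Gcase) (n : ℕ) (i : Fin (n + 1)) (p0 : ℕ) : ℕ → CF n → CF n
  | 0, x => x
  | (m + 1), x => adF c n i (cpar c n i * m + p0) (adFiter c n i p0 m x)

/-- Defining relations of the quantum affine superalgebra `U_q(g)` (Definition 2.1). -/
inductive CRel (c : Gcase) (n : ℕ) : CF n → CF n → Prop
  | k_ki (i : Fin (n + 1)) : CRel c n (cK i * cKi i) 1
  | ki_k (i : Fin (n + 1)) : CRel c n (cKi i * cK i) 1
  | k_comm (i j : Fin (n + 1)) : CRel c n (cK i * cK j) (cK j * cK i)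
  | k_e (i j : Fin (n + 1)) :
      CRel c n (cK i * cE j * cKi i) (qpow (2 * cB c n i j) • cE j)
  | k_f (i j : Fin (n + 1)) :
      CRel c n (cK i * cF j * cKi i) (qpow (-(2 * cB c n i j)) • cF j)
  | e_f (i j : Fin (n + 1)) :
      CRel c n (cE i * cF j - ((-1 : KK) ^ (cpar c n i * cpar c n j)) • (cF j * cE i))
        (if i = j then (cden c n i)⁻¹ • (cK i - cKi i) else 0)
  | serre_e (i j : Fin (n + 1)) (h : i ≠ j) :
      CRel c n (adEiter c n i (cpar c n j) (1 - cacart c n i j).toNat (cE j)) 0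
  | serre_f (i j : Fin (n + 1)) (h : i ≠ j) :
      CRel c n (adFiter c n i (cpar c n j) (1 - cacart c n i j).toNat (cF j)) 0

/-- The quantum affine superalgebra `U_q(g)`. -/
abbrev Uq (c : Gcase) (n : ℕ) : Type := RingQuot (CRel c n)

def cπ (c : Gcase) (n : ℕ) : CF n →ₐ[KK] Uq c n := RingQuot.mkAlgHom KK (CRel c n)

def wE (c : Gcase) (n : ℕ) (i : Fin (n + 1)) : Uq c n := cπ c n (cE i)
def wF (c : Gcase) (n : ℕ) (i : Fin (n + 1)) : Uq c n := cπ c n (cF i)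
def wK (c : Gcase) (n : ℕ) (i : Fin (n + 1)) : Uq c n := cπ c n (cK i)
def wKi (c : Gcase) (n : ℕ) (i : Fin (n + 1)) : Uq c n := cπ c n (cKi i)

/-! ## Adjoint chains in `U_q^D(g)` -/

/-- `Ad_{ξ⁻_{i,0}}(x) = ξ⁻_{i,0} x − (−1)^{[ξ⁻_{i,0}][x]} γ_i⁻¹ x γ_i ξ⁻_{i,0}`. -/
def AdXmQ (c : Gcase) (n : ℕ) (i : Fin n) (p : ℕ) (x : UqD c n) : UqD c n :=
  vXm c n i 0 * x -
    ((-1 : KK) ^ (dpar n i * p)) • (vGai c n i * x * vGa c n i * vXm c n i 0)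

/-- `Ad_{ξ⁺_{i,0}}(x) = ξ⁺_{i,0} x − (−1)^{[ξ⁺_{i,0}][x]} γ_i x γ_i⁻¹ ξ⁺_{i,0}`. -/
def AdXpQ (c : Gcase) (n : ℕ) (i : Fin n) (p : ℕ) (x : UqD c n) : UqD c n :=
  vXp c n i 0 * x -
    ((-1 : KK) ^ (dpar n i * p)) • (vGa c n i * x * vGai c n i * vXp c n i 0)

/-- iterated `Ad_{ξ⁻}` along a list of indices (head applied last), with parity
book-keeping: `p0` is the parity of the initial element `x`. -/
def adChainM (c : Gcase) (n : ℕ) : List (Fin n) → ℕ → UqD c n → UqD c n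
  | [], _, x => x
  | (i :: t), p0, x => AdXmQ c n i ((t.map (dpar n)).sum + p0) (adChainM c n t p0 x)

def adChainP (c : Gcase) (n : ℕ) : List (Fin n) → ℕ → UqD c n → UqD c n
  | [], _, x => x
  | (i :: t), p0, x => AdXpQ c n i ((t.map (dpar n)).sum + p0) (adChainP c n t p0 x)

/-- `m % n` as an element of `Fin n`. -/
def fnat (n : ℕ) [NeZero n] (m : ℕ) : Fin n :=
  ⟨m % n, Nat.mod_lt _ (Nat.pos_of_ne_zero (NeZero.ne n))⟩

/-! ## The vertex operator (Fock space) representation for `osp(1|2n)^{(1)}` -/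

/-- `℘^{1/2} = √−1·q^{1/2}`. -/
def phh : KK := ii * qh
/-- `℘^{m/2}`. -/
def php (m : ℤ) : KK := phh ^ m

/-- The root lattice `Q` of `osp(1|2n)` in coordinates w.r.t. the basis `α_1, …, α_n`. -/
abbrev Qlat (n : ℕ) : Type := Fin n →₀ ℤ

/-- The variables `κ_{i, −(m+1)}` of `S(η⁻)`. -/
abbrev Vars (n : ℕ) : Type := Fin n × ℕ

/-- `S(η⁻)`. -/
abbrev Spoly (n : ℕ) : Type := MvPolynomial (Vars n) KK

/-- The Fock space `V = S(η⁻) ⊗ ℂ[Q]`, realised as the free `S(η⁻)`-module on `Q`. -/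
abbrev Vfock (n : ℕ) : Type := Qlat n →₀ Spoly n

/-- the scalar `u_{i,j,s}(℘^s − ℘^{−s})/(s(q_i−q_i⁻¹)(q_j−q_j⁻¹))`. -/
def Hscal (n : ℕ) (i j : Fin n) (s : ℤ) : KK :=
  du Gcase.osp1 n i j s * (php (2 * s) - php (-(2 * s))) /
    ((s : KK) * dden Gcase.osp1 n i * dden Gcase.osp1 n j)

/-- The Heisenberg operators `H_i(s)` on `S(η⁻)`: multiplication by `κ_{i,s}` for `s < 0`,
and the derivation with `H_i(s)(κ_{j,r}) = δ_{r,−s}·u_{i,j,s}(℘^s−℘^{−s})/(s(q_i−q_i⁻¹)(q_j−q_j⁻¹))`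
for `s > 0`. -/
def Hop (n : ℕ) (i : Fin n) (s : ℤ) : Module.End KK (Spoly n) :=
  if s < 0 then
    LinearMap.mulLeft KK (MvPolynomial.X (R := KK) ((i, (-s - 1).toNat) : Vars n))
  else if 0 < s then
    (MvPolynomial.mkDerivation KK (fun v : Vars n =>
      if ((v.2 : ℤ) + 1) = s then MvPolynomial.C (Hscal n i v.1 s) else 0)).toLinearMap
  else 0

/-- `{k}_{q_i} = (℘^k − ℘^{−k})/(q_i − q_i⁻¹)`. -/
def brk (n : ℕ) (i : Fin n) (k : ℕ) : KK :=
  (php (2 * (k : ℤ)) - php (-(2 * (k : ℤ)))) / dden Gcase.osp1 n i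

/-- The coefficient operators of `exp(Σ_{k≥1} a_k z^{±k})`: `expCoeff a m` is the coefficient
of `z^{±m}`, characterised by the recursion `(m+1)·E_{m+1} = Σ_{k=1}^{m+1} k a_k E_{m+1−k}`
(the `a_k` commute). -/
def expCoeff {n : ℕ} (a : ℕ → Module.End KK (Spoly n)) : ℕ → Module.End KK (Spoly n)
  | 0 => 1
  | (m + 1) =>
      (((m : KK) + 1))⁻¹ •
        ∑ k ∈ Finset.range (m + 1),
          (((k : ℕ) + 1 : ℕ) : KK) • (a (k + 1) * expCoeff a (m - k))
  decreasing_by exact Nat.lt_succ_of_le (Nat.sub_le m k)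

/-- coefficients of `E⁺_i(z) = exp(Σ_{k≥1} (℘^{−k/2}/{k}_{q_i}) H_i(−k) z^k)`. -/
def EEp (n : ℕ) (i : Fin n) : ℕ → Module.End KK (Spoly n) :=
  expCoeff fun k => (php (-(k : ℤ)) / brk n i k) • Hop n i (-(k : ℤ))
/-- coefficients of `F⁺_i(z) = exp(−Σ_{k≥1} (℘^{−k/2}/{k}_{q_i}) H_i(k) z^{−k})`. -/
def FFp (n : ℕ) (i : Fin n) : ℕ → Module.End KK (Spoly n) :=
  expCoeff fun k => (-(php (-(k : ℤ)) / brk n i k)) • Hop n i (k : ℤ)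
/-- coefficients of `E⁻_i(z) = exp(−Σ_{k≥1} (℘^{k/2}/{k}_{q_i}) H_i(−k) z^k)`. -/
def EEm (n : ℕ) (i : Fin n) : ℕ → Module.End KK (Spoly n) :=
  expCoeff fun k => (-(php ((k : ℤ)) / brk n i k)) • Hop n i (-(k : ℤ))
/-- coefficients of `F⁻_i(z) = exp(Σ_{k≥1} (℘^{k/2}/{k}_{q_i}) H_i(k) z^{−k})`. -/
def FFm (n : ℕ) (i : Fin n) : ℕ → Module.End KK (Spoly n) :=
  expCoeff fun k => (php ((k : ℤ)) / brk n i k) • Hop n i (k : ℤ)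

/-- `(α_i, β)` for `β ∈ Q`. -/
def rowB (n : ℕ) (i : Fin n) (β : Qlat n) : ℤ := β.sum fun j m => dB Gcase.osp1 n i j * m

/-- the sign operator `Φ` on `e^β`: `(−1)^{Σ_{k ≥ lo} (α_{k+1}, β)}` (`lo` 0-based). -/
def phiSgn (n : ℕ) (lo : ℕ) (β : Qlat n) : KK :=
  (-1 : KK) ^ (∑ k ∈ Finset.univ.filter (fun k : Fin n => lo ≤ (k : ℕ)), rowB n k β)

/-- the integer `ℓ(α_i)/2` rounded into the mode convention: `1` for `i < n`, `0` for `i = n`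
(where the genuine `ℓ(α_n)/2 = 1/2` is absorbed in the half-integral mode expansion
`X^±_n(z) = Σ_k X^±_n(k) z^{−k±1/2}`). -/
def shiftP (n : ℕ) (i : Fin n) : ℤ := if pid i = n then 0 else 1

/-- the weight of a monomial of `S(η⁻)` (the variable `κ_{i,r}` has weight `−r`). -/
def wtm (n : ℕ) (m : Vars n →₀ ℕ) : ℕ := m.sum fun v mult => mult * (v.2 + 1)

/-- The mode `X⁺_i(k)` of the vertex operator `X⁺_i(z) = E⁺_i(z) F⁺_i(z) T⁺_i(z)`,
`T⁺_i(z) = e^{α_i} Φ_i z^{∂_{α_i} + ℓ(α_i)/2}`.  On `p ⊗ e^β` only the finitely many terms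
with `j ≤ wt(p)` contribute (`F⁺_{i,j}` lowers the weight by `j`). -/
def XpOp (n : ℕ) (i : Fin n) (k : ℤ) : Module.End KK (Vfock n) :=
  Finsupp.lsum KK fun β : Qlat n =>
    ((MvPolynomial.basisMonomials (Vars n) KK).constr KK fun mono : Vars n →₀ ℕ =>
      phiSgn n (i : ℕ) β •
        Finsupp.single (β + Finsupp.single i 1)
          (∑ j ∈ Finset.range (wtm n mono + 1),
            (if 0 ≤ (j : ℤ) - k - rowB n i β - shiftP n i then
              (EEp n i (((j : ℤ) - k - rowB n i β - shiftP n i).toNat))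
                ((FFp n i j) (MvPolynomial.monomial mono 1))
             else 0)))

/-- The mode `X⁻_i(k)` of `X⁻_i(z) = E⁻_i(z) F⁻_i(z) T⁻_i(z)`,
`T⁻_i(z) = e^{−α_i} Φ_{i+1} z^{−∂_{α_i} + ℓ(α_i)/2}`. -/
def XmOp (n : ℕ) (i : Fin n) (k : ℤ) : Module.End KK (Vfock n) :=
  Finsupp.lsum KK fun β : Qlat n =>
    ((MvPolynomial.basisMonomials (Vars n) KK).constr KK fun mono : Vars n →₀ ℕ =>
      phiSgn n ((i : ℕ) + 1) β •
        Finsupp.single (β - Finsupp.single i 1)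
          (∑ j ∈ Finset.range (wtm n mono + 1),
            (if 0 ≤ (j : ℤ) - k + rowB n i β - shiftP n i then
              (EEm n i (((j : ℤ) - k + rowB n i β - shiftP n i).toNat))
                ((FFm n i j) (MvPolynomial.monomial mono 1))
             else 0)))

/-- The operator `γ_i ↦ ϖ_i σ_i ℘^{∂_{α_i}}`:  `e^β ↦ ϖ_i (−1)^{(α_i,β)} ℘^{(α_i,β)} e^β`. -/
def GaOp (n : ℕ) (i : Fin n) : Module.End KK (Vfock n) :=
  Finsupp.lsum KK fun β : Qlat n =>
    (((if pid i = n then phh⁻¹ else 1) * ((-1 : KK) ^ (rowB n i β)) * php (2 * rowB n i β)) •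
      (Finsupp.lsingle β : Spoly n →ₗ[KK] Vfock n))

/-- The operator `κ_{i,s} ↦ H_i(s)` extended to `V`. -/
def KaOp (n : ℕ) (i : Fin n) (s : ℤ) : Module.End KK (Vfock n) :=
  Finsupp.mapRange.linearMap (Hop n i s)

/-- the scalar `ϱ_i = −{ℓ(α_i)/2}_{q_i}`. -/
def rhoi (n : ℕ) (i : Fin n) : KK :=
  -((php (dB Gcase.osp1 n i i) - php (-(dB Gcase.osp1 n i i))) / dden Gcase.osp1 n i)

section ExpCoeff

variable {n : ℕ}

/-- Extension by zero of a sequence to all integer indices. -/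
def extZ {A : Type*} [Zero A] (f : ℕ → A) (m : ℤ) : A := if 0 ≤ m then f m.toNat else 0

lemma extZ_of_neg {A : Type*} [Zero A] (f : ℕ → A) {m : ℤ} (hm : m < 0) : extZ f m = 0 :=
  if_neg (not_le.2 hm)

@[simp] lemma extZ_natCast {A : Type*} [Zero A] (f : ℕ → A) (m : ℕ) : extZ f (m : ℤ) = f m := by
  simp [extZ]

@[simp] lemma expCoeff_zero (a : ℕ → Module.End KK (Spoly n)) : expCoeff a 0 = 1 := by
  rw [expCoeff]

lemma extZ_expCoeff_zero (a : ℕ → Module.End KK (Spoly n)) : extZ (expCoeff a) 0 = 1 := by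
  simp [extZ]

/-- Euler's identity `p E_p = Σ_{k ≥ 1} k a_k E_{p-k}` for the coefficients of an exponential. -/
lemma extZ_expCoeff_euler (a : ℕ → Module.End KK (Spoly n)) (N : ℕ) (p : ℤ) (hp : p ≤ N) :
    (p : KK) • extZ (expCoeff a) p =
      ∑ k ∈ Finset.range N, ((k : KK) + 1) • (a (k + 1) * extZ (expCoeff a) (p - 1 - k)) := by
  rcases le_or_gt p 0 with h | h
  · have hz : ∀ k ∈ Finset.range N,
        ((k : KK) + 1) • (a (k + 1) * extZ (expCoeff a) (p - 1 - k)) = 0 := fun k _ => by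
      rw [extZ_of_neg _ (by omega), mul_zero, smul_zero]
    rw [Finset.sum_eq_zero hz]
    rcases h.lt_or_eq with h | rfl
    · rw [extZ_of_neg _ h, smul_zero]
    · simp
  · obtain ⟨m, rfl⟩ : ∃ m : ℕ, p = ((m + 1 : ℕ) : ℤ) := ⟨p.toNat - 1, by omega⟩
    rw [extZ_natCast, expCoeff, smul_smul]
    have hm : (((m + 1 : ℕ) : ℤ) : KK) * ((m : KK) + 1)⁻¹ = 1 := by
      push_cast
      exact mul_inv_cancel₀ (Nat.cast_add_one_ne_zero m)
    rw [hm, one_smul]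
    have hsub : Finset.range (m + 1) ⊆ Finset.range N := by
      intro x; simp only [Finset.mem_range]; omega
    rw [← Finset.sum_subset hsub]
    · refine Finset.sum_congr rfl fun k hk => ?_
      have hk' : k ≤ m := by simpa [Nat.lt_succ_iff] using hk
      have : (((m + 1 : ℕ) : ℤ) - 1 - k) = ((m - k : ℕ) : ℤ) := by omega
      rw [this, extZ_natCast]
      push_cast
      rfl
    · intro k _ hk
      have hk' : m + 1 ≤ k := by simpa using hk
      rw [extZ_of_neg _ (by omega), mul_zero, smul_zero]

lemma commute_expCoeff {x : Module.End KK (Spoly n)} {a : ℕ → Module.End KK (Spoly n)}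
    (h : ∀ k, Commute x (a (k + 1))) (m : ℕ) : Commute x (expCoeff a m) := by
  induction m using Nat.strong_induction_on with
  | _ m ih =>
    cases m with
    | zero => simp
    | succ m =>
      rw [expCoeff]
      refine Commute.smul_right (Commute.sum_right _ _ _ fun k _ => ?_) _
      exact Commute.smul_right ((h k).mul_right (ih _ (by omega))) _

lemma commute_expCoeff_expCoeff {a b : ℕ → Module.End KK (Spoly n)}
    (h : ∀ k l, Commute (a (k + 1)) (b (l + 1))) (m p : ℕ) :
    Commute (expCoeff a m) (expCoeff b p) :=
  commute_expCoeff (fun l => (commute_expCoeff (fun k => (h k l).symm) m).symm) p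

lemma commute_extZ {A : Type*} [MonoidWithZero A] {f g : ℕ → A} (h : ∀ m p, Commute (f m) (g p))
    (m p : ℤ) : Commute (extZ f m) (extZ g p) := by
  unfold extZ
  split_ifs <;> simp [h]

/-- If `[a_k, b_l] = δ_{kl} s_k`, then `[a_k, E_p] = s_k E_{p-k}` for `E = exp b`. -/
lemma bracket_extZ_expCoeff {a b : ℕ → Module.End KK (Spoly n)} {s : ℕ → KK}
    (h : ∀ k l, a (k + 1) * b (l + 1) = b (l + 1) * a (k + 1) + if k = l then s k • 1 else 0)
    (k : ℕ) (p : ℤ) :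
    a (k + 1) * extZ (expCoeff b) p =
      extZ (expCoeff b) p * a (k + 1) + s k • extZ (expCoeff b) (p - 1 - k) := by
  suffices H : ∀ (N : ℕ) (p : ℤ), p ≤ N → a (k + 1) * extZ (expCoeff b) p =
      extZ (expCoeff b) p * a (k + 1) + s k • extZ (expCoeff b) (p - 1 - k) from
    H p.toNat p (by omega)
  intro N
  induction N with
  | zero =>
    intro p hp
    rw [extZ_of_neg _ (show p - 1 - k < 0 by push_cast at hp; omega)]
    rcases lt_or_eq_of_le hp with hp | rfl
    · rw [extZ_of_neg _ (by simpa using hp)]; simp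
    · simp [extZ_expCoeff_zero]
  | succ N ih =>
    intro p hp
    rcases lt_or_eq_of_le hp with hp' | hp'
    · exact ih p (by omega)
    have hp0 : (p : KK) ≠ 0 := by rw [hp']; push_cast; exact Nat.cast_add_one_ne_zero N
    apply smul_right_injective _ hp0
    have e1 := extZ_expCoeff_euler b (N + 1) p hp
    have e2 := extZ_expCoeff_euler b (N + 1) (p - 1 - k) (by omega)
    have key : ∀ l ∈ Finset.range (N + 1),
        a (k + 1) * (((l : KK) + 1) • (b (l + 1) * extZ (expCoeff b) (p - 1 - l))) =
          (((l : KK) + 1) • (b (l + 1) * extZ (expCoeff b) (p - 1 - l))) * a (k + 1) +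
          s k • (((l : KK) + 1) • (b (l + 1) * extZ (expCoeff b) (p - 1 - k - 1 - l))) +
          if k = l then (((k : KK) + 1) * s k) • extZ (expCoeff b) (p - 1 - k) else 0 := by
      intro l _
      have hl := ih (p - 1 - l) (by omega)
      rw [mul_smul_comm, ← mul_assoc, h, add_mul, mul_assoc, hl,
        show p - 1 - (l : ℤ) - 1 - k = p - 1 - k - 1 - l by ring]
      split_ifs with hkl
      · subst hkl
        generalize (k : KK) + 1 = c
        simp only [mul_add, smul_add, mul_smul_comm, smul_mul_assoc, one_mul, mul_assoc, smul_smul]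
        rw [mul_comm (s k)]
      · generalize (l : KK) + 1 = c
        simp only [mul_add, smul_add, mul_smul_comm, smul_mul_assoc, zero_mul, mul_assoc, smul_smul,
          add_zero]
        rw [mul_comm (s k)]
    change (p : KK) • (a (k + 1) * _) = (p : KK) • (_ + _)
    rw [← mul_smul_comm, e1, Finset.mul_sum, Finset.sum_congr rfl key, Finset.sum_add_distrib,
      Finset.sum_add_distrib, ← Finset.sum_mul, ← e1, ← Finset.smul_sum, ← e2, smul_add,
      smul_mul_assoc, add_assoc, Finset.sum_ite_eq]
    congr 1
    split_ifs with hk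
    · rw [smul_smul, smul_smul, ← add_smul]
      congr 1
      push_cast
      ring
    · rw [extZ_of_neg _ (by simp at hk; omega)]
      simp

/-- If `[a_k, b_l] = δ_{kl} t^k / k`, then `(1 - t w / z) F(z) E(w) = E(w) F(z)` for
`F(z) = exp (Σ a_k z^{-k})` and `E(w) = exp (Σ b_k w^k)`. -/
lemma extZ_expCoeff_exchange {a b : ℕ → Module.End KK (Spoly n)} {s : ℕ → KK} {t : KK}
    (h : ∀ k l, a (k + 1) * b (l + 1) = b (l + 1) * a (k + 1) + if k = l then s k • 1 else 0)
    (hs : ∀ k : ℕ, ((k : KK) + 1) * s k = t ^ (k + 1)) (m p : ℤ) :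
    extZ (expCoeff a) m * extZ (expCoeff b) p =
      extZ (expCoeff b) p * extZ (expCoeff a) m +
        t • (extZ (expCoeff a) (m - 1) * extZ (expCoeff b) (p - 1)) := by
  suffices H : ∀ (N : ℕ) (m : ℤ), m ≤ N → ∀ p, extZ (expCoeff a) m * extZ (expCoeff b) p =
      extZ (expCoeff b) p * extZ (expCoeff a) m +
        t • (extZ (expCoeff a) (m - 1) * extZ (expCoeff b) (p - 1)) from
    H m.toNat m (by omega) p
  intro N
  induction N with
  | zero =>
    intro m hm p
    rw [extZ_of_neg _ (show m - 1 < 0 by push_cast at hm; omega)]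
    rcases lt_or_eq_of_le hm with hm | rfl
    · rw [extZ_of_neg _ (by simpa using hm)]; simp
    · simp [extZ_expCoeff_zero]
  | succ N ih =>
    intro m hm p
    rcases lt_or_eq_of_le hm with hm' | hm'
    · exact ih m (by omega) p
    have hm0 : (m : KK) ≠ 0 := by rw [hm']; push_cast; exact Nat.cast_add_one_ne_zero N
    apply smul_right_injective _ hm0
    have e1 := extZ_expCoeff_euler a (N + 1) m hm
    have e2 := extZ_expCoeff_euler a (N + 1) (m - 1) (by omega)
    have key : ∀ k ∈ Finset.range (N + 1),
        ((k : KK) + 1) • (a (k + 1) * extZ (expCoeff a) (m - 1 - k)) * extZ (expCoeff b) p =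
          extZ (expCoeff b) p * (((k : KK) + 1) • (a (k + 1) * extZ (expCoeff a) (m - 1 - k))) +
          t • ((((k : KK) + 1) • (a (k + 1) * extZ (expCoeff a) (m - 1 - 1 - k))) *
            extZ (expCoeff b) (p - 1)) +
          t • (t ^ k • (extZ (expCoeff a) (m - 1 - k) * extZ (expCoeff b) (p - 1 - k)) -
            t ^ (k + 1) • (extZ (expCoeff a) (m - 1 - (k + 1 : ℕ)) *
              extZ (expCoeff b) (p - 1 - (k + 1 : ℕ)))) := by
      intro k _
      have h1 := ih (m - 1 - k) (by omega) p
      have h2 := ih (m - 1 - k) (by omega) (p - 1 - k)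
      have h3 := bracket_extZ_expCoeff h k p
      rw [show m - 1 - ((k + 1 : ℕ) : ℤ) = m - 1 - k - 1 by push_cast; ring,
        show p - 1 - ((k + 1 : ℕ) : ℤ) = p - 1 - k - 1 by push_cast; ring, h2,
        show m - 1 - 1 - (k : ℤ) = m - 1 - k - 1 by ring,
        smul_mul_assoc, mul_assoc, h1, mul_add, ← mul_assoc, h3]
      have hk := hs k
      generalize (k : KK) + 1 = c at hk ⊢
      simp only [add_mul, smul_add, mul_smul_comm, smul_mul_assoc, mul_assoc, smul_smul, hk]
      simp only [smul_sub, smul_add, smul_smul, pow_succ, mul_comm]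
      abel
    change (m : KK) • (_ * _) = (m : KK) • (_ + _)
    rw [← smul_mul_assoc, e1, Finset.sum_mul, Finset.sum_congr rfl key, Finset.sum_add_distrib,
      Finset.sum_add_distrib, ← Finset.mul_sum, ← e1, ← Finset.smul_sum, ← Finset.sum_mul, ← e2,
      ← Finset.smul_sum, Finset.sum_range_sub'
        (fun k : ℕ => t ^ k • (extZ (expCoeff a) (m - 1 - k) * extZ (expCoeff b) (p - 1 - k))),
      extZ_of_neg (expCoeff a) (show m - 1 - ((N + 1 : ℕ) : ℤ) < 0 by omega)]
    simp only [pow_zero, one_smul, zero_mul, smul_zero, sub_zero, Nat.cast_zero, smul_add,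
      mul_smul_comm, smul_mul_assoc, add_assoc]
    congr 1
    rw [smul_smul, smul_smul, ← add_smul]
    congr 1
    push_cast
    ring

end ExpCoeff

section Weight

variable {n : ℕ}

/-- The span of the monomials of weight at most `d`. -/
def weightLE (n : ℕ) (d : ℤ) : Submodule KK (Spoly n) :=
  Submodule.span KK {p | ∃ m : Vars n →₀ ℕ, (wtm n m : ℤ) ≤ d ∧ p = MvPolynomial.monomial m 1}

lemma monomial_mem_weightLE {d : ℤ} {m : Vars n →₀ ℕ} (h : (wtm n m : ℤ) ≤ d) (c : KK) :
    MvPolynomial.monomial m c ∈ weightLE n d := by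
  have : MvPolynomial.monomial m c = c • MvPolynomial.monomial m (1 : KK) := by
    rw [MvPolynomial.smul_monomial, smul_eq_mul, mul_one]
  rw [this]
  exact Submodule.smul_mem _ _ (Submodule.subset_span ⟨m, h, rfl⟩)

lemma weightLE_of_neg {d : ℤ} (hd : d < 0) : weightLE n d = ⊥ := by
  rw [weightLE, Submodule.span_eq_bot]
  rintro _ ⟨m, hm, -⟩
  omega

lemma weightLE_mono {d e : ℤ} (h : d ≤ e) : weightLE n d ≤ weightLE n e :=
  Submodule.span_mono fun _ ⟨m, hm, hp⟩ => ⟨m, hm.trans h, hp⟩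

lemma wtm_tsub_single (m : Vars n →₀ ℕ) (v : Vars n) (hv : m v ≠ 0) :
    wtm n (m - Finsupp.single v 1) + (v.2 + 1) = wtm n m := by
  have h1 : m = (m - Finsupp.single v 1) + Finsupp.single v 1 := by
    ext w
    by_cases h : w = v
    · subst h; simp; omega
    · simp [Ne.symm h]
  conv_rhs => rw [h1]
  unfold wtm
  rw [Finsupp.sum_add_index' (by simp) (by intros; ring)]
  simp

lemma exists_mem_weightLE (p : Spoly n) : ∃ d : ℕ, p ∈ weightLE n d := by
  induction p using MvPolynomial.induction_on' with
  | monomial m c => exact ⟨wtm n m, monomial_mem_weightLE le_rfl c⟩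
  | add p q hp hq =>
    obtain ⟨d, hd⟩ := hp
    obtain ⟨e, he⟩ := hq
    exact ⟨max d e, Submodule.add_mem _ (weightLE_mono (by simp) hd) (weightLE_mono (by simp) he)⟩

lemma Hop_natCast_succ (i : Fin n) (k : ℕ) :
    Hop n i ((k + 1 : ℕ) : ℤ) = (MvPolynomial.mkDerivation KK (fun v : Vars n =>
      if v.2 = k then MvPolynomial.C (Hscal n i v.1 ((k + 1 : ℕ) : ℤ)) else 0)).toLinearMap := by
  unfold Hop
  rw [if_neg (by omega), if_pos (by omega)]
  congr 2
  funext v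
  have : ((v.2 : ℤ) + 1 = ((k + 1 : ℕ) : ℤ)) ↔ v.2 = k := by omega
  simp only [this]

lemma Hop_neg_natCast_succ (i : Fin n) (k : ℕ) :
    Hop n i (-((k + 1 : ℕ) : ℤ)) =
      LinearMap.mulLeft KK (MvPolynomial.X (R := KK) ((i, k) : Vars n)) := by
  unfold Hop
  rw [if_pos (by omega), show (- -((k + 1 : ℕ) : ℤ) - 1).toNat = k by omega]

lemma Hop_mem_weightLE (i : Fin n) (k : ℕ) {d : ℤ} {p : Spoly n} (hp : p ∈ weightLE n d) :
    Hop n i ((k + 1 : ℕ) : ℤ) p ∈ weightLE n (d - (k + 1)) := by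
  induction hp using Submodule.span_induction with
  | mem p hp =>
    obtain ⟨m, hm, rfl⟩ := hp
    rw [Hop_natCast_succ]
    change MvPolynomial.mkDerivation KK _ _ ∈ _
    rw [MvPolynomial.mkDerivation_monomial, one_smul]
    refine Submodule.sum_mem _ fun v hv => ?_
    have hv' : m v ≠ 0 := by simpa using hv
    dsimp only
    split_ifs with h
    · rw [smul_eq_mul, mul_comm, MvPolynomial.C_mul_monomial]
      apply monomial_mem_weightLE
      have := wtm_tsub_single m v hv'
      omega
    · simp
  | zero => simp
  | add p q _ _ hp hq => rw [map_add]; exact Submodule.add_mem _ hp hq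
  | smul c p _ hp => rw [map_smul]; exact Submodule.smul_mem _ _ hp

lemma expCoeff_mem_weightLE {a : ℕ → Module.End KK (Spoly n)}
    (ha : ∀ (k : ℕ) (d : ℤ) (p : Spoly n), p ∈ weightLE n d →
      a (k + 1) p ∈ weightLE n (d - (k + 1)))
    (m : ℕ) {d : ℤ} {p : Spoly n} (hp : p ∈ weightLE n d) :
    expCoeff a m p ∈ weightLE n (d - m) := by
  induction m using Nat.strong_induction_on generalizing d p with
  | _ m ih =>
    cases m with
    | zero => simpa using hp
    | succ m =>
      rw [expCoeff, LinearMap.smul_apply, LinearMap.sum_apply]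
      refine Submodule.smul_mem _ _ (Submodule.sum_mem _ fun k hk => ?_)
      have hk' : k < m + 1 := by simpa using hk
      rw [LinearMap.smul_apply, Module.End.mul_apply]
      refine Submodule.smul_mem _ _ ?_
      have := ha k _ _ (ih (m - k) (by omega) hp)
      rwa [show d - ((m - k : ℕ) : ℤ) - (k + 1) = d - ((m + 1 : ℕ) : ℤ) by omega] at this

lemma FFp_eq_zero (i : Fin n) {d : ℤ} {p : Spoly n} (hp : p ∈ weightLE n d) {m : ℕ}
    (hm : d < m) : FFp n i m p = 0 := by
  have h : FFp n i m p ∈ weightLE n (d - m) :=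
    expCoeff_mem_weightLE
      (fun k d p hp => Submodule.smul_mem _ _ (Hop_mem_weightLE i k hp)) m hp
  rwa [weightLE_of_neg (by omega), Submodule.mem_bot] at h

lemma Hop_pos_mul_neg (i j : Fin n) (k l : ℕ) :
    Hop n i ((k + 1 : ℕ) : ℤ) * Hop n j (-((l + 1 : ℕ) : ℤ)) =
      Hop n j (-((l + 1 : ℕ) : ℤ)) * Hop n i ((k + 1 : ℕ) : ℤ) +
        if k = l then Hscal n i j ((k + 1 : ℕ) : ℤ) • 1 else 0 := by
  rw [Hop_natCast_succ, Hop_neg_natCast_succ]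
  refine LinearMap.ext fun p => ?_
  simp only [Module.End.mul_apply, LinearMap.mulLeft_apply, LinearMap.add_apply,
    Derivation.coeFn_coe, Derivation.leibniz,
    MvPolynomial.mkDerivation_X, smul_eq_mul]
  by_cases h : k = l
  · subst h
    simp [MvPolynomial.smul_eq_C_mul, mul_comm]
  · simp [h, Ne.symm h]

lemma Hop_pos_commute (i j : Fin n) (k l : ℕ) :
    Commute (Hop n i ((k + 1 : ℕ) : ℤ)) (Hop n j ((l + 1 : ℕ) : ℤ)) := by
  rw [Hop_natCast_succ, Hop_natCast_succ]
  set D : Derivation KK (Spoly n) (Spoly n) := MvPolynomial.mkDerivation KK (fun v : Vars n =>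
    if v.2 = k then MvPolynomial.C (Hscal n i v.1 ((k + 1 : ℕ) : ℤ)) else 0)
  set D' : Derivation KK (Spoly n) (Spoly n) := MvPolynomial.mkDerivation KK (fun v : Vars n =>
    if v.2 = l then MvPolynomial.C (Hscal n j v.1 ((l + 1 : ℕ) : ℤ)) else 0)
  have h : ⁅D, D'⁆ = 0 := by
    refine MvPolynomial.derivation_ext fun v => ?_
    rw [Derivation.commutator_apply, MvPolynomial.mkDerivation_X, MvPolynomial.mkDerivation_X]
    split_ifs <;> simp
  refine LinearMap.ext fun p => ?_
  have := congrArg (fun E => E p) h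
  simpa [Derivation.commutator_apply, sub_eq_zero] using this

lemma Hop_neg_commute (i j : Fin n) (k l : ℕ) :
    Commute (Hop n i (-((k + 1 : ℕ) : ℤ))) (Hop n j (-((l + 1 : ℕ) : ℤ))) := by
  rw [Hop_neg_natCast_succ, Hop_neg_natCast_succ]
  refine LinearMap.ext fun p => ?_
  simp [mul_left_comm]

end Weight

section Scalars

variable {n : ℕ}

lemma qh_ne_zero : qh ≠ 0 := RatFunc.X_ne_zero

lemma qpow_add (a b : ℤ) : qpow (a + b) = qpow a * qpow b := zpow_add₀ qh_ne_zero a b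

lemma qpow_ne_one {a : ℕ} (ha : a ≠ 0) : qpow a ≠ 1 := by
  have hX : (Polynomial.X ^ a : Polynomial ℂ) ≠ 1 := fun h => by
    have := congrArg Polynomial.natDegree h
    simp [ha] at this
  intro h
  apply hX
  apply RatFunc.algebraMap_injective ℂ
  rw [map_pow, RatFunc.algebraMap_X, map_one]
  simpa [qpow, qh] using h

lemma qpow_sub_qpow_neg_ne_zero {a : ℕ} (ha : a ≠ 0) : qpow a - qpow (-a) ≠ 0 := by
  intro h
  apply qpow_ne_one (a := a + a) (by omega)
  rw [Nat.cast_add, qpow_add]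
  nth_rewrite 1 [sub_eq_zero.1 h]
  rw [← qpow_add, neg_add_cancel]
  simp [qpow]

lemma ii_sq : ii * ii = -1 := by
  rw [ii, ← map_mul, Complex.I_mul_I, map_neg, map_one]

lemma php_two_mul (k : ℤ) : php (2 * k) = (-1) ^ k * qpow (2 * k) := by
  rw [php, qpow, zpow_mul, zpow_mul, ← mul_zpow]
  congr 1
  have : phh * phh = -(qh * qh) := by
    rw [phh, mul_mul_mul_comm, ii_sq, neg_one_mul]
  rw [show (2 : ℤ) = ((2 : ℕ) : ℤ) from rfl, zpow_natCast, zpow_natCast, sq, sq, this, neg_one_mul]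

lemma php_sq (k : ℤ) : php k * php k = php (2 * k) := by
  have : phh ≠ 0 := mul_ne_zero (fun h => by simpa [h] using ii_sq) qh_ne_zero
  rw [php, php, ← zpow_add₀ this, two_mul]

lemma dB_self_pos (i : Fin n) : ∃ a : ℕ, a ≠ 0 ∧ dB Gcase.osp1 n i i = a := by
  unfold dB Bc pid
  by_cases h : (i : ℕ) + 1 = n
  · exact ⟨1, one_ne_zero, by simp [h, i.pos.ne']⟩
  · exact ⟨2, two_ne_zero, by simp [h]⟩

lemma dden_ne_zero (i : Fin n) : dden Gcase.osp1 n i ≠ 0 := by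
  obtain ⟨a, ha, h⟩ := dB_self_pos i
  have := qpow_sub_qpow_neg_ne_zero ha
  rwa [dden, dqi, h, qpow, ← zpow_neg]

lemma dB_comm (i j : Fin n) : dB Gcase.osp1 n i j = dB Gcase.osp1 n j i := by
  unfold dB Bc
  by_cases h : pid i = pid j
  · simp [h]
  · simp only [h, Ne.symm h, if_false, or_comm]

lemma du_of_adj {i j : Fin n} (hij : i ≠ j) (hadj : dB Gcase.osp1 n i j = -1) (r : ℤ) :
    du Gcase.osp1 n i j r = qpow (-(2 * r)) - qpow (2 * r) := by
  have h : ¬(pid i = n ∧ pid j = n) := fun h => hij (Fin.ext (by simp only [pid] at h; omega))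
  rw [dB] at hadj
  simp only [du, uconst, if_neg h, hadj]
  ring_nf

lemma php_sub_php_neg (k : ℤ) :
    php (2 * k) - php (-(2 * k)) = (-1) ^ k * (qpow (2 * k) - qpow (-(2 * k))) := by
  rw [← mul_neg 2 k, php_two_mul, php_two_mul, zpow_neg, ← inv_zpow, inv_neg_one, mul_neg]
  ring

/-- The scalar of the exchange relation between `F⁺_i` and `E⁺_j` for adjacent `i`, `j`. -/
lemma exchange_scalar {i j : Fin n} (hij : i ≠ j) (hadj : dB Gcase.osp1 n i j = -1) (k : ℕ) :
    ((k : KK) + 1) * (-(php (-((k + 1 : ℕ) : ℤ)) / brk n i (k + 1)) *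
      (php (-((k + 1 : ℕ) : ℤ)) / brk n j (k + 1)) * Hscal n i j ((k + 1 : ℕ) : ℤ)) =
      qpow (-2) ^ (k + 1) := by
  unfold brk Hscal
  rw [du_of_adj hij hadj, php_sub_php_neg]
  have h1 : (-1 : KK) ^ ((k + 1 : ℕ) : ℤ) * (-1 : KK) ^ ((k + 1 : ℕ) : ℤ) = 1 := by
    rw [← mul_zpow]; simp
  have h2 : php (-((k + 1 : ℕ) : ℤ)) * php (-((k + 1 : ℕ) : ℤ)) =
      (-1 : KK) ^ ((k + 1 : ℕ) : ℤ) * qpow (-2) ^ (k + 1) := by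
    rw [php_sq, php_two_mul, zpow_neg, ← inv_zpow, inv_neg_one, qpow, qpow, ← zpow_natCast,
      ← zpow_mul]
    congr 2
  have h3 : qpow (2 * ((k + 1 : ℕ) : ℤ)) - qpow (-(2 * ((k + 1 : ℕ) : ℤ))) ≠ 0 := by
    have := qpow_sub_qpow_neg_ne_zero (a := 2 * (k + 1)) (by omega)
    push_cast at this ⊢
    exact this
  have h4 : (((k + 1 : ℕ) : ℤ) : KK) = (k : KK) + 1 := by push_cast; rfl
  have h5 : (k : KK) + 1 ≠ 0 := Nat.cast_add_one_ne_zero k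
  have h6 : (-1 : KK) ^ ((k + 1 : ℕ) : ℤ) ≠ 0 := zpow_ne_zero _ (by simp)
  have hi := dden_ne_zero i
  have hj := dden_ne_zero j
  rw [h4]
  generalize (-1 : KK) ^ ((k + 1 : ℕ) : ℤ) = e at *
  generalize php (-((k + 1 : ℕ) : ℤ)) = f at *
  rw [← neg_sub (qpow (2 * ((k + 1 : ℕ) : ℤ)))]
  generalize qpow (2 * ((k + 1 : ℕ) : ℤ)) - qpow (-(2 * ((k + 1 : ℕ) : ℤ))) = g at *
  generalize qpow (-2) ^ (k + 1) = t at *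
  field_simp
  linear_combination h2

end Scalars

section NormalOrder

variable {n : ℕ}

lemma rowB_add (i : Fin n) (β γ : Qlat n) : rowB n i (β + γ) = rowB n i β + rowB n i γ :=
  Finsupp.sum_add_index' (by simp) (by intros; ring)

lemma rowB_single (i j : Fin n) : rowB n i (Finsupp.single j 1) = dB Gcase.osp1 n i j := by
  simp [rowB]

lemma phiSgn_add (lo : ℕ) (β γ : Qlat n) :
    phiSgn n lo (β + γ) = phiSgn n lo β * phiSgn n lo γ := by
  simp only [phiSgn, rowB_add, Finset.sum_add_distrib]
  exact zpow_add₀ (by simp) _ _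

lemma sum_dB_filter (lo : ℕ) (j : Fin n) :
    ∑ k ∈ Finset.univ.filter (fun k : Fin n => lo ≤ (k : ℕ)), dB Gcase.osp1 n k j =
      ∑ k ∈ Finset.Ico lo n, Bc Gcase.osp1 n (k + 1) (j + 1) := by
  rw [Finset.sum_filter]
  change ∑ k : Fin n, (if lo ≤ (k : ℕ) then Bc Gcase.osp1 n ((k : ℕ) + 1) (j + 1) else 0) = _
  rw [Fin.sum_univ_eq_sum_range
    (fun k => if lo ≤ k then Bc Gcase.osp1 n (k + 1) (j + 1) else 0) n, ← Finset.sum_filter]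
  refine Finset.sum_congr ?_ fun _ _ => rfl
  ext k
  simp [and_comm]

lemma Bc_succ_eq_zero {k j : ℕ} (h1 : k ≠ j) (h2 : k + 1 ≠ j) (h3 : j + 1 ≠ k) :
    Bc Gcase.osp1 n (k + 1) (j + 1) = 0 := by
  simp [Bc, h1, h2, h3]

lemma phiSgn_single_succ {i j : Fin n} (h : (i : ℕ) + 1 = j) :
    phiSgn n i (Finsupp.single j 1) = 1 ∧ phiSgn n j (Finsupp.single i 1) = -1 := by
  obtain ⟨i, hi⟩ := i
  obtain ⟨j, hj⟩ := j
  dsimp only at h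
  subst h
  simp only [phiSgn, rowB_single, sum_dB_filter]
  constructor
  · rw [Finset.sum_eq_sum_Ico_succ_bot hi, Finset.sum_eq_sum_Ico_succ_bot hj]
    by_cases hn : i + 1 + 1 = n
    · subst hn
      simp [Bc]
    · have hlt : i + 1 + 1 < n := by omega
      rw [Finset.sum_eq_sum_Ico_succ_bot hlt, Finset.sum_eq_zero]
      · simp [Bc, hn]
      · intro k hk
        rw [Finset.mem_Ico] at hk
        exact Bc_succ_eq_zero (by omega) (by omega) (by omega)
  · rw [Finset.sum_eq_sum_Ico_succ_bot hj, Finset.sum_eq_zero]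
    · simp [Bc, inv_neg_one]
    · intro k hk
      rw [Finset.mem_Ico] at hk
      exact Bc_succ_eq_zero (by omega) (by omega) (by omega)

lemma succ_eq_of_dB_eq_neg_one {i j : Fin n} (hij : i ≠ j) (hadj : dB Gcase.osp1 n i j = -1) :
    (i : ℕ) + 1 = j ∨ (j : ℕ) + 1 = i := by
  by_contra! h
  have : dB Gcase.osp1 n i j = 0 :=
    Bc_succ_eq_zero (fun e => hij (Fin.ext e)) h.1 h.2
  omega

/-- The cocycle `Φ` is antisymmetric on adjacent simple roots. -/
lemma phiSgn_single_of_adj {i j : Fin n} (hij : i ≠ j) (hadj : dB Gcase.osp1 n i j = -1) :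
    phiSgn n i (Finsupp.single j 1) = -phiSgn n j (Finsupp.single i 1) := by
  rcases succ_eq_of_dB_eq_neg_one hij hadj with h | h
  · rw [(phiSgn_single_succ h).1, (phiSgn_single_succ h).2, neg_neg]
  · rw [(phiSgn_single_succ h).1, (phiSgn_single_succ h).2]

lemma commute_EEp (i j : Fin n) (m p : ℤ) : Commute (extZ (EEp n i) m) (extZ (EEp n j) p) :=
  commute_extZ (commute_expCoeff_expCoeff fun k l =>
    ((Hop_neg_commute i j k l).smul_left _).smul_right _) m p

lemma commute_FFp (i j : Fin n) (m p : ℕ) : Commute (FFp n i m) (FFp n j p) :=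
  commute_expCoeff_expCoeff (fun k l => ((Hop_pos_commute i j k l).smul_left _).smul_right _) m p

/-- `(1 - q⁻¹ w / z) F⁺_i(z) E⁺_j(w) = E⁺_j(w) F⁺_i(z)` for adjacent `i`, `j`. -/
lemma FFp_mul_EEp {i j : Fin n} (hij : i ≠ j) (hadj : dB Gcase.osp1 n i j = -1) (m p : ℤ) :
    extZ (FFp n i) m * extZ (EEp n j) p = extZ (EEp n j) p * extZ (FFp n i) m +
      qpow (-2) • (extZ (FFp n i) (m - 1) * extZ (EEp n j) (p - 1)) := by
  refine extZ_expCoeff_exchange (fun k l => ?_) (exchange_scalar hij hadj) m p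
  rw [smul_mul_smul_comm, smul_mul_smul_comm, Hop_pos_mul_neg, smul_add]
  congr 1
  · rw [mul_comm]
  · split_ifs with h
    · subst h; rw [smul_smul]
    · rw [smul_zero]

/-- The coefficient of `z^{-K}` in `E⁺_i(z) F⁺_i(z)`, with `F⁺_i` truncated to the first `N` terms. -/
def vertexSum (n : ℕ) (i : Fin n) (K : ℤ) (N : ℕ) : Module.End KK (Spoly n) :=
  ∑ j ∈ Finset.range N, extZ (EEp n i) (j - K) * FFp n i j

lemma vertexSum_apply_eq (i : Fin n) (K : ℤ) {d : ℕ} {p : Spoly n} (hp : p ∈ weightLE n d)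
    {M N : ℕ} (hM : d < M) (hN : d < N) : vertexSum n i K M p = vertexSum n i K N p := by
  have key : ∀ {M : ℕ}, d < M → vertexSum n i K (d + 1) p = vertexSum n i K M p := by
    intro M hM
    simp only [vertexSum, LinearMap.sum_apply, Module.End.mul_apply]
    refine Finset.sum_subset (by intro x; simp only [Finset.mem_range]; omega) fun j _ hj => ?_
    rw [FFp_eq_zero i hp (by simp at hj; omega), map_zero]
  exact (key hM).symm.trans (key hN)

lemma XpOp_single (i : Fin n) (k : ℤ) (β : Qlat n) {d : ℕ} {p : Spoly n} (hp : p ∈ weightLE n d)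
    {N : ℕ} (hN : d < N) :
    XpOp n i k (Finsupp.single β p) = phiSgn n i β •
      Finsupp.single (β + Finsupp.single i 1)
        (vertexSum n i (k + rowB n i β + shiftP n i) N p) := by
  induction hp using Submodule.span_induction with
  | mem p hp =>
    obtain ⟨m, hm, rfl⟩ := hp
    rw [vertexSum_apply_eq i _ (monomial_mem_weightLE (le_refl (wtm n m : ℤ)) 1)
      (show wtm n m < N by omega) (Nat.lt_succ_self _)]
    have hb : (MvPolynomial.monomial m 1 : Spoly n) = MvPolynomial.basisMonomials (Vars n) KK m :=
      (congrFun (MvPolynomial.coe_basisMonomials (Vars n) KK) m).symm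
    unfold XpOp
    rw [Finsupp.lsum_single, hb, Module.Basis.constr_basis, ← hb, vertexSum, LinearMap.sum_apply]
    congr 2
    refine Finset.sum_congr rfl fun j _ => ?_
    rw [Module.End.mul_apply, extZ, sub_sub, sub_sub, add_assoc k]
    split_ifs <;> rfl
  | zero => simp
  | add p q _ _ hp hq =>
    rw [Finsupp.single_add, map_add, hp, hq, map_add, Finsupp.single_add, smul_add]
  | smul c p _ hp =>
    rw [← Finsupp.smul_single, map_smul, hp, map_smul, ← Finsupp.smul_single, smul_comm]

lemma XpOp_mul_sub {i j : Fin n} (hij : i ≠ j) (hadj : dB Gcase.osp1 n i j = -1) (k l : ℤ)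
    (β : Qlat n) (p : Spoly n) :
    ∃ N₀ : ℕ, ∀ M N : ℕ, N₀ ≤ M → N₀ ≤ N →
      (XpOp n i (k + 1) * XpOp n j l - qpow (-2) • (XpOp n i k * XpOp n j (l + 1)))
          (Finsupp.single β p) =
        (phiSgn n i (β + Finsupp.single j 1) * phiSgn n j β) •
          Finsupp.single (β + Finsupp.single j 1 + Finsupp.single i 1)
            (∑ m ∈ Finset.range M, ∑ r ∈ Finset.range N,
              (extZ (EEp n i) (m - (k + rowB n i β + shiftP n i)) *
                extZ (EEp n j) (r - (l + rowB n j β + shiftP n j)) *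
                  (FFp n i m * FFp n j r)) p) := by
  obtain ⟨d, hd⟩ := exists_mem_weightLE p
  set K := k + rowB n i β + shiftP n i with hK
  set L := l + rowB n j β + shiftP n j with hL
  obtain ⟨d₁, h₁⟩ := exists_mem_weightLE (vertexSum n j L (d + 1) p)
  obtain ⟨d₂, h₂⟩ := exists_mem_weightLE (vertexSum n j (L + 1) (d + 1) p)
  refine ⟨d + d₁ + d₂ + 2, fun M N hM hN => ?_⟩
  obtain ⟨M, rfl⟩ : ∃ M', M = M' + 1 := ⟨M - 1, by omega⟩
  rw [vertexSum_apply_eq (N := N) j L hd (Nat.lt_succ_self d) (by omega)] at h₁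
  rw [vertexSum_apply_eq (N := N) j (L + 1) hd (Nat.lt_succ_self d) (by omega)] at h₂
  have e1 : k + 1 + rowB n i (β + Finsupp.single j 1) + shiftP n i = K := by
    rw [rowB_add, rowB_single, hadj, hK]; ring
  have e2 : k + rowB n i (β + Finsupp.single j 1) + shiftP n i = K - 1 := by
    rw [rowB_add, rowB_single, hadj, hK]; ring
  have e3 : l + 1 + rowB n j β + shiftP n j = L + 1 := by rw [hL]; ring
  rw [LinearMap.sub_apply, LinearMap.smul_apply, Module.End.mul_apply, Module.End.mul_apply,
    XpOp_single j l β hd (show d < N by omega), XpOp_single j (l + 1) β hd (show d < N by omega),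
    ← hL, e3, map_smul, map_smul, XpOp_single i (k + 1) _ h₁ (show d₁ < M + 1 by omega),
    XpOp_single i k _ h₂ (show d₂ < M by omega), e1, e2]
  have key : vertexSum n i K (M + 1) (vertexSum n j L N p) -
      qpow (-2) • vertexSum n i (K - 1) M (vertexSum n j (L + 1) N p) =
      ∑ m ∈ Finset.range (M + 1), ∑ r ∈ Finset.range N,
        (extZ (EEp n i) (m - K) * extZ (EEp n j) (r - L) * (FFp n i m * FFp n j r)) p := by
    have shift : vertexSum n i (K - 1) M = ∑ m ∈ Finset.range (M + 1),
        extZ (EEp n i) (m - K) * extZ (FFp n i) (m - 1) := by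
      rw [Finset.sum_range_succ', extZ_of_neg (FFp n i) (by simp), mul_zero, add_zero]
      refine Finset.sum_congr rfl fun m _ => ?_
      rw [Nat.cast_add_one, add_sub_cancel_right, extZ_natCast]
      congr 2
      ring
    rw [shift]
    have expand : ∀ m r : ℕ,
        extZ (EEp n i) (m - K) * extZ (EEp n j) (r - L) * (FFp n i m * FFp n j r) =
        extZ (EEp n i) (m - K) * FFp n i m * (extZ (EEp n j) (r - L) * FFp n j r) -
          qpow (-2) • (extZ (EEp n i) (m - K) * extZ (FFp n i) (m - 1) *
            (extZ (EEp n j) (r - (L + 1)) * FFp n j r)) := by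
      intro m r
      have h := FFp_mul_EEp hij hadj m (r - L)
      rw [extZ_natCast, sub_sub] at h
      rw [eq_sub_iff_add_eq, ← mul_smul_comm, mul_assoc, mul_assoc, mul_assoc, ← mul_smul_comm]
      rw [← mul_assoc (FFp n i m), h]
      simp only [mul_add, add_mul, mul_smul_comm, smul_mul_assoc, mul_assoc]
    simp only [expand, ← LinearMap.sum_apply, Finset.sum_sub_distrib, ← Finset.mul_sum,
      ← Finset.smul_sum, ← Finset.sum_mul]
    rfl
  rw [← key]
  simp only [Finsupp.single_sub, smul_sub, Finsupp.smul_single, smul_smul]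
  rw [mul_comm (phiSgn n j β), mul_comm (qpow (-2))]

end NormalOrder

/-- For `g = osp(1|2n)^{(1)}` and `1 ≤ i, j ≤ n` with `i ≠ j` and
`(α_i, α_j) = −1`, the vertex operators satisfy
`(z − q⁻¹w)·X⁺_i(z)X⁺_j(w) = (q⁻¹z − w)·X⁺_j(w)X⁺_i(z)`; comparing coefficients of the mode
expansions, for all `k, l`:
`X⁺_i(k+1)X⁺_j(l) − q⁻¹X⁺_i(k)X⁺_j(l+1) = q⁻¹X⁺_j(l)X⁺_i(k+1) − X⁺_j(l+1)X⁺_i(k)`. -/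
theorem vertex_operator_qcommutation (n : ℕ) [NeZero n] (i j : Fin n) (hij : i ≠ j)
    (hadj : dB Gcase.osp1 n i j = -1) (k l : ℤ) :
    XpOp n i (k + 1) * XpOp n j l - qpow (-2) • (XpOp n i k * XpOp n j (l + 1)) =
      qpow (-2) • (XpOp n j l * XpOp n i (k + 1)) - XpOp n j (l + 1) * XpOp n i k := by
  refine Finsupp.lhom_ext fun β p => ?_
  obtain ⟨N₁, h₁⟩ := XpOp_mul_sub hij hadj k l β p
  obtain ⟨N₂, h₂⟩ := XpOp_mul_sub hij.symm ((dB_comm j i).trans hadj) l k β p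
  have h₁ := h₁ (max N₁ N₂) (max N₁ N₂) (le_max_left _ _) (le_max_left _ _)
  have h₂ := h₂ (max N₁ N₂) (max N₁ N₂) (le_max_right _ _) (le_max_right _ _)
  rw [← neg_sub (XpOp n j (l + 1) * XpOp n i k), LinearMap.neg_apply, h₁, h₂, ← neg_smul,
    Finset.sum_comm, add_right_comm]
  congr 1
  · rw [phiSgn_add, phiSgn_add, phiSgn_single_of_adj hij hadj]
    ring
  · refine congrArg (Finsupp.single (β + Finsupp.single i 1 + Finsupp.single j 1))
      (Finset.sum_congr rfl fun r _ => Finset.sum_congr rfl fun m _ => ?_)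
    rw [(commute_EEp i j _ _).eq, (commute_FFp i j m r).eq]
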